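/- Fix integers k, l ≥ 1. Then, as q → 1⁻ (with q ∈ (0,1)), the ratio Ẽ_{2k}(q)·Ẽ_{2l}(q) / Ẽ_{2k+2l}(q) tends to 1. -/

import Mathlib

open Filter Topology Finset Real

/-- The Eisenstein series `E_{2k}(q) = 1 + (2/ζ(1-2k)) ∑_{n≥1} σ_{2k-1}(n) qⁿ`. -/
noncomputable def eisenstein (k : ℕ) (q : ℝ) : ℂ :=
  1 + 2 / riemannZeta (1 - 2 * (k : ℂ)) *
    (((∑' n : ℕ, (∑ d ∈ Nat.divisors (n + 1), (d : ℝ) ^ (2 * k - 1)) * q ^ (n + 1)) : ℝ) : ℂ)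

/-- The modified Eisenstein series `Ẽ_{2k}(q) = E_{2k}(q) + 2ζ(2-2k)/(ζ(1-2k)·log q)`. -/
noncomputable def eisensteinMod (k : ℕ) (q : ℝ) : ℂ :=
  eisenstein k q +
    2 * riemannZeta (2 - 2 * (k : ℂ)) / (riemannZeta (1 - 2 * (k : ℂ)) * (Real.log q : ℂ))

/-- The polylogarithm type sum `∑_{n ≥ 1} n^s r^n`. -/
noncomputable def polySum (s : ℕ) (r : ℝ) : ℝ := ∑' n : ℕ, ((n : ℝ) + 1) ^ s * r ^ (n + 1)

lemma polySum_summable (s : ℕ) {r : ℝ} (h0 : 0 < r) (h1 : r < 1) :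
    Summable (fun n : ℕ => ((n : ℝ) + 1) ^ s * r ^ (n + 1)) := by
  have h := summable_pow_mul_geometric_of_norm_lt_one (R := ℝ) s (r := r)
    (by rw [Real.norm_eq_abs, abs_of_pos h0]; exact h1)
  have := (summable_nat_add_iff 1).2 h
  simpa using this

lemma polySum_le (s : ℕ) {r : ℝ} (h0 : 0 < r) (h1 : r < 1) :
    polySum s r ≤ s.factorial * r / (1 - r) ^ (s + 1) := by
  have hr : ‖r‖ < 1 := by rw [Real.norm_eq_abs, abs_of_pos h0]; exact h1
  have h := (hasSum_choose_mul_geometric_of_norm_lt_one s hr).mul_left (s.factorial * r)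
  have h2 := (polySum_summable s h0 h1).hasSum
  have h3 := hasSum_le (fun n => ?_) h2 h
  · unfold polySum
    calc _ ≤ _ := h3
      _ = _ := by ring
  · have : ((n : ℝ) + 1) ^ s ≤ s.factorial * ((n + s).choose s : ℝ) := by
      have := Nat.pow_succ_le_ascFactorial (n + 1) s
      rw [Nat.ascFactorial_eq_factorial_mul_choose] at this
      exact_mod_cast this
    calc ((n : ℝ) + 1) ^ s * r ^ (n + 1) ≤ (s.factorial * ((n + s).choose s : ℝ)) * r ^ (n + 1) := by
          gcongr
      _ = _ := by ring

lemma le_polySum (u : ℕ) {r : ℝ} (h0 : 0 < r) (h1 : r < 1) :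
    (u + 1).factorial * r ^ (u + 1) / (1 - r) ^ (u + 2) ≤ polySum (u + 1) r := by
  have hr : ‖r‖ < 1 := by rw [Real.norm_eq_abs, abs_of_pos h0]; exact h1
  have h := (hasSum_choose_mul_geometric_of_norm_lt_one (u + 1) hr).mul_left
    ((u + 1).factorial * r ^ (u + 1))
  have hs := polySum_summable (u + 1) h0 h1
  have h2 := ((summable_nat_add_iff u).2 hs).hasSum
  have h3 := hasSum_le (fun n => ?_) h h2
  · have h4 := hs.sum_add_tsum_nat_add u
    have h5 : 0 ≤ ∑ i ∈ Finset.range u, ((i : ℝ) + 1) ^ (u + 1) * r ^ (i + 1) :=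
      Finset.sum_nonneg fun i _ => by positivity
    unfold polySum
    calc _ = (u + 1).factorial * r ^ (u + 1) * (1 / (1 - r) ^ (u + 1 + 1)) := by ring
      _ ≤ _ := h3
      _ ≤ _ := by linarith
  · have : ((u + 1).factorial : ℝ) * ((n + (u + 1)).choose (u + 1) : ℝ)
        ≤ (((n + u : ℕ) : ℝ) + 1) ^ (u + 1) := by
      have := Nat.descFactorial_le_pow (n + (u + 1)) (u + 1)
      rw [Nat.descFactorial_eq_factorial_mul_choose] at this
      exact_mod_cast this
    calc _ = (((u + 1).factorial : ℝ) * ((n + (u + 1)).choose (u + 1) : ℝ)) * r ^ (n + u + 1) := by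
          ring
      _ ≤ _ := by gcongr

lemma polySum_nonneg (s : ℕ) {r : ℝ} (h0 : 0 < r) : 0 ≤ polySum s r :=
  tsum_nonneg fun n => by positivity

lemma scaled_bound (s : ℕ) {x : ℝ} (hx : 0 < x) :
    x ^ (s + 1) * polySum s (exp (-x)) ≤ s.factorial * ((s + 1).factorial * exp 1) := by
  have e1 : exp (-x) < 1 := by rw [Real.exp_lt_one_iff]; linarith
  have h := polySum_le s (exp_pos (-x)) e1
  have h2 : x / (1 + x) ≤ 1 - exp (-x) := by
    have : exp (-x) ≤ 1 / (1 + x) := by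
      rw [Real.exp_neg, ← one_div]
      apply one_div_le_one_div_of_le (by linarith)
      linarith [Real.add_one_le_exp x]
    have h4 : x / (1 + x) = 1 - 1 / (1 + x) := by field_simp; ring
    linarith
  have h3 : x / (1 - exp (-x)) ≤ 1 + x := by
    rw [div_le_iff₀ (by linarith)]
    rw [div_le_iff₀ (by linarith)] at h2
    linarith
  have h5 := Real.pow_div_factorial_le_exp (x := 1 + x) (by linarith) (s + 1)
  rw [div_le_iff₀ (by positivity)] at h5
  have hpos : 0 < 1 - exp (-x) := by linarith
  calc x ^ (s + 1) * polySum s (exp (-x))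
      ≤ x ^ (s + 1) * (s.factorial * exp (-x) / (1 - exp (-x)) ^ (s + 1)) := by gcongr
    _ = s.factorial * ((x / (1 - exp (-x))) ^ (s + 1) * exp (-x)) := by
        rw [div_pow]; ring
    _ ≤ s.factorial * ((1 + x) ^ (s + 1) * exp (-x)) := by gcongr
    _ ≤ s.factorial * ((exp (1 + x) * (s + 1).factorial) * exp (-x)) := by gcongr
    _ = _ := by
        have : exp (1 + x) * exp (-x) = exp 1 := by rw [← Real.exp_add]; congr 1; ring
        rw [← this]; ring

lemma scaled_tendsto (u : ℕ) :
    Tendsto (fun x : ℝ => x ^ (u + 2) * polySum (u + 1) (exp (-x))) (𝓝[>] 0)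
      (𝓝 ((u + 1).factorial : ℝ)) := by
  have h1 : Tendsto (fun x : ℝ => x / (1 - exp (-x))) (𝓝[>] 0) (𝓝 1) := by
    have hd : HasDerivAt (fun x : ℝ => 1 - exp (-x)) 1 0 := by
      have := ((hasDerivAt_neg (0 : ℝ)).exp).const_sub 1
      simpa using this
    have := hd.tendsto_slope.mono_left (nhdsWithin_mono 0 (fun x (hx : 0 < x) => ne_of_gt hx))
    have := this.inv₀ one_ne_zero
    rw [inv_one] at this
    refine this.congr fun x => ?_
    simp [slope_def_field]
  have he : Tendsto (fun x : ℝ => exp (-x)) (𝓝[>] 0) (𝓝 1) := by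
    have : Tendsto (fun x : ℝ => exp (-x)) (𝓝 0) (𝓝 (exp (-0))) :=
      (Real.continuous_exp.comp continuous_neg).tendsto 0
    rw [neg_zero, Real.exp_zero] at this
    exact this.mono_left nhdsWithin_le_nhds
  have hlo : Tendsto (fun x : ℝ => ((u + 1).factorial : ℝ) * exp (-x) ^ (u + 1) *
      (x / (1 - exp (-x))) ^ (u + 2)) (𝓝[>] 0) (𝓝 ((u + 1).factorial : ℝ)) := by
    have := ((he.pow (u + 1)).const_mul ((u + 1).factorial : ℝ)).mul (h1.pow (u + 2))
    simpa using this
  have hhi : Tendsto (fun x : ℝ => ((u + 1).factorial : ℝ) * exp (-x) *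
      (x / (1 - exp (-x))) ^ (u + 2)) (𝓝[>] 0) (𝓝 ((u + 1).factorial : ℝ)) := by
    have := (he.const_mul ((u + 1).factorial : ℝ)).mul (h1.pow (u + 2))
    simpa using this
  refine tendsto_of_tendsto_of_tendsto_of_le_of_le' hlo hhi ?_ ?_
  · filter_upwards [self_mem_nhdsWithin] with x hx
    have hx : 0 < x := hx
    have e1 : exp (-x) < 1 := by rw [Real.exp_lt_one_iff]; linarith
    have h := le_polySum u (exp_pos (-x)) e1
    calc _ = x ^ (u + 2) * (((u + 1).factorial : ℝ) * exp (-x) ^ (u + 1) /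
            (1 - exp (-x)) ^ (u + 2)) := by rw [div_pow]; ring
      _ ≤ _ := by gcongr
  · filter_upwards [self_mem_nhdsWithin] with x hx
    have hx : 0 < x := hx
    have e1 : exp (-x) < 1 := by rw [Real.exp_lt_one_iff]; linarith
    have h := polySum_le (u + 1) (exp_pos (-x)) e1
    calc _ ≤ x ^ (u + 2) * (((u + 1).factorial : ℝ) * exp (-x) /
            (1 - exp (-x)) ^ (u + 1 + 1)) := by gcongr
      _ = _ := by rw [div_pow]; ring

lemma divisorSum_eq (s : ℕ) {q : ℝ} (h0 : 0 < q) (h1 : q < 1) :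
    ∑' n : ℕ, (∑ d ∈ Nat.divisors (n + 1), (d : ℝ) ^ s) * q ^ (n + 1) =
      ∑' m : ℕ, polySum s (q ^ (m + 1)) := by
  have hr : ‖q‖ < 1 := by rw [Real.norm_eq_abs, abs_of_pos h0]; exact h1
  have h := tsum_prod_pow_eq_tsum_sigma s hr
  rw [tsum_pnat_eq_tsum_succ (f := fun e : ℕ => (ArithmeticFunction.sigma s e : ℝ) * q ^ e),
    tsum_pnat_eq_tsum_succ (f := fun d : ℕ => ∑' c : ℕ+, ((c : ℕ) : ℝ) ^ s * q ^ (d * (c : ℕ)))] at h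
  rw [show (∑' n : ℕ, (∑ d ∈ Nat.divisors (n + 1), (d : ℝ) ^ s) * q ^ (n + 1)) =
    ∑' n : ℕ, (ArithmeticFunction.sigma s (n + 1) : ℝ) * q ^ (n + 1) from
      tsum_congr fun n => by simp [ArithmeticFunction.sigma_apply], ← h]
  refine tsum_congr fun m => ?_
  rw [tsum_pnat_eq_tsum_succ (f := fun c : ℕ => (c : ℝ) ^ s * q ^ ((m + 1) * c))]
  unfold polySum
  refine tsum_congr fun c => ?_
  rw [pow_mul]; push_cast; rfl

lemma lambert_tendsto (u : ℕ) :
    Tendsto (fun q : ℝ => (-Real.log q) ^ (u + 2) *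
      ∑' n : ℕ, (∑ d ∈ Nat.divisors (n + 1), (d : ℝ) ^ (u + 1)) * q ^ (n + 1))
      (𝓝[Set.Ioo (0 : ℝ) 1] 1)
      (𝓝 (∑' m : ℕ, ((u + 1).factorial : ℝ) * (1 / ((m : ℝ) + 1) ^ (u + 2)))) := by
  have ht : Tendsto (fun q : ℝ => -Real.log q) (𝓝[Set.Ioo (0 : ℝ) 1] 1) (𝓝[>] 0) := by
    refine tendsto_nhdsWithin_iff.2 ⟨?_, ?_⟩
    · have : Tendsto (fun q : ℝ => -Real.log q) (𝓝 1) (𝓝 (-Real.log 1)) :=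
        (Real.continuousAt_log one_ne_zero).neg
      rw [Real.log_one, neg_zero] at this
      exact this.mono_left nhdsWithin_le_nhds
    · filter_upwards [self_mem_nhdsWithin] with q hq
      have := Real.log_neg hq.1 hq.2
      simpa using this
  have key : ∀ q ∈ Set.Ioo (0 : ℝ) 1, ∀ m : ℕ,
      (-Real.log q) ^ (u + 2) * polySum (u + 1) (q ^ (m + 1)) =
      ((((m : ℝ) + 1) * (-Real.log q)) ^ (u + 2) *
        polySum (u + 1) (exp (-(((m : ℝ) + 1) * (-Real.log q))))) *
          (1 / ((m : ℝ) + 1) ^ (u + 2)) := by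
    intro q hq m
    have e : exp (-(((m : ℝ) + 1) * (-Real.log q))) = q ^ (m + 1) := by
      rw [mul_neg, neg_neg, mul_comm, ← Real.rpow_def_of_pos hq.1]
      exact_mod_cast Real.rpow_natCast q (m + 1)
    have : ((m : ℝ) + 1) ≠ 0 := by positivity
    rw [e, mul_pow]
    field_simp
  have main : Tendsto (fun q : ℝ => ∑' m : ℕ, (-Real.log q) ^ (u + 2) *
      polySum (u + 1) (q ^ (m + 1))) (𝓝[Set.Ioo (0 : ℝ) 1] 1)
      (𝓝 (∑' m : ℕ, ((u + 1).factorial : ℝ) * (1 / ((m : ℝ) + 1) ^ (u + 2)))) := by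
    refine tendsto_tsum_of_dominated_convergence (bound := fun m : ℕ =>
      (((u + 1).factorial : ℝ) * ((u + 1 + 1).factorial * exp 1)) *
        (1 / ((m : ℝ) + 1) ^ (u + 2))) ?_ ?_ ?_
    · apply Summable.mul_left
      have := (summable_nat_add_iff 1).2
        (Real.summable_one_div_nat_pow.2 (by omega : 1 < u + 2))
      simpa using this
    · intro m
      have hm : Tendsto (fun q : ℝ => ((m : ℝ) + 1) * (-Real.log q))
          (𝓝[Set.Ioo (0 : ℝ) 1] 1) (𝓝[>] 0) := by
        refine tendsto_nhdsWithin_iff.2 ⟨?_, ?_⟩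
        · simpa using (tendsto_nhds_of_tendsto_nhdsWithin ht).const_mul ((m : ℝ) + 1)
        · filter_upwards [(tendsto_nhdsWithin_iff.1 ht).2] with q hq
          have hq : 0 < -Real.log q := hq
          rw [Set.mem_Ioi]
          positivity
      refine (((scaled_tendsto u).comp hm).mul_const _).congr' ?_
      filter_upwards [self_mem_nhdsWithin] with q hq
      exact (key q hq m).symm
    · filter_upwards [self_mem_nhdsWithin] with q hq m
      have hl : 0 < -Real.log q := by linarith [Real.log_neg hq.1 hq.2]
      rw [key q hq m, Real.norm_eq_abs, abs_of_nonneg]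
      · have := scaled_bound (u + 1) (x := ((m : ℝ) + 1) * (-Real.log q)) (by positivity)
        gcongr
      · have := polySum_nonneg (u + 1) (exp_pos (-(((m : ℝ) + 1) * (-Real.log q))))
        positivity
  refine main.congr' ?_
  filter_upwards [self_mem_nhdsWithin] with q hq
  rw [divisorSum_eq (u + 1) hq.1 hq.2, tsum_mul_left]

lemma eisensteinMod_tendsto (k : ℕ) (hk : 1 ≤ k) :
    Tendsto (fun q : ℝ => ((-Real.log q : ℝ) : ℂ) ^ (2 * k) * eisensteinMod k q)
      (𝓝[Set.Ioo (0 : ℝ) 1] 1) (𝓝 ((-1) ^ k * (2 * (π : ℂ)) ^ (2 * k))) := by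
  obtain ⟨j, rfl⟩ := Nat.exists_eq_add_of_le' hk
  have ht : Tendsto (fun q : ℝ => ((-Real.log q : ℝ) : ℂ)) (𝓝[Set.Ioo (0 : ℝ) 1] 1) (𝓝 0) := by
    have : Tendsto (fun q : ℝ => -Real.log q) (𝓝 1) (𝓝 (-Real.log 1)) :=
      (Real.continuousAt_log one_ne_zero).neg
    rw [Real.log_one, neg_zero] at this
    exact_mod_cast (Complex.continuous_ofReal.tendsto 0).comp (this.mono_left nhdsWithin_le_nhds)
  have hS := (Complex.continuous_ofReal.tendsto _).comp (lambert_tendsto (2 * j))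
  set Z := riemannZeta (1 - 2 * ((j + 1 : ℕ) : ℂ)) with hZ
  set W := riemannZeta (2 - 2 * ((j + 1 : ℕ) : ℂ)) with hW
  have hlim : (((∑' m : ℕ, ((2 * j + 1).factorial : ℝ) * (1 / ((m : ℝ) + 1) ^ (2 * j + 2))) : ℝ) : ℂ)
      = (2 * j + 1).factorial * riemannZeta ((2 * j + 2 : ℕ) : ℂ) := by
    have hsum : Summable (fun n : ℕ => 1 / (n : ℂ) ^ (2 * j + 2)) := by
      have := Real.summable_one_div_nat_pow.2 (by omega : 1 < 2 * j + 2)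
      have h2 := Complex.summable_ofReal.2 this
      simpa using h2
    rw [zeta_nat_eq_tsum_of_gt_one (by omega), tsum_mul_left, hsum.tsum_eq_zero_add]
    push_cast
    simp
  have hz0 : riemannZeta ((2 * j + 2 : ℕ) : ℂ) ≠ 0 :=
    riemannZeta_ne_zero_of_one_le_re (by norm_cast; omega)
  have hfe : Z = 2 * ((2 * (π : ℂ)) ^ (2 * j + 2))⁻¹ * (2 * j + 1).factorial * (-1) ^ (j + 1) *
      riemannZeta ((2 * j + 2 : ℕ) : ℂ) := by
    have := riemannZeta_one_sub (s := ((2 * j + 2 : ℕ) : ℂ)) (fun n h => by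
      have h2 : ((2 * j + 2 + n : ℕ) : ℂ) = 0 := by push_cast at h ⊢; rw [h]; ring
      norm_cast at h2; omega) (by norm_cast; omega)
    rw [hZ, show (1 - 2 * ((j + 1 : ℕ) : ℂ)) = 1 - ((2 * j + 2 : ℕ) : ℂ) by push_cast; ring, this]
    congr 2
    · congr 1
      · rw [Complex.cpow_neg, Complex.cpow_natCast]
      · have := Complex.Gamma_nat_eq_factorial (2 * j + 1)
        rw [← this]; push_cast; ring_nf
    · rw [show (π : ℂ) * ((2 * j + 2 : ℕ) : ℂ) / 2 = ((j + 1 : ℕ) : ℂ) * π by push_cast; ring]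
      exact_mod_cast congrArg Complex.ofReal (Real.cos_nat_mul_pi (j + 1))
  have hpi : (2 * (π : ℂ)) ≠ 0 := by
    simp [Real.pi_ne_zero]
  have hfac : (((2 * j + 1).factorial : ℕ) : ℂ) ≠ 0 := by exact_mod_cast Nat.factorial_ne_zero _
  have hZ0 : Z ≠ 0 := by
    rw [hfe]
    have : ((-1 : ℂ)) ^ (j + 1) ≠ 0 := pow_ne_zero _ (by norm_num)
    exact mul_ne_zero (mul_ne_zero (mul_ne_zero (mul_ne_zero two_ne_zero
      (inv_ne_zero (pow_ne_zero _ hpi))) hfac) this) hz0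
  have h := ((ht.pow (2 * j + 2)).add (hS.const_mul (2 / Z))).add
    ((ht.pow (2 * j + 1)).const_mul (-(2 * W / Z)))
  have hval : (0 : ℂ) ^ (2 * j + 2) + 2 / Z * (((∑' m : ℕ, ((2 * j + 1).factorial : ℝ) *
      (1 / ((m : ℝ) + 1) ^ (2 * j + 2))) : ℝ) : ℂ) + -(2 * W / Z) * 0 ^ (2 * j + 1) =
      (-1) ^ (j + 1) * (2 * (π : ℂ)) ^ (2 * (j + 1)) := by
    rw [hlim, zero_pow (by omega), zero_pow (by omega), zero_add, mul_zero, add_zero, hfe]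
    have h1 : ((-1 : ℂ)) ^ (j + 1) ≠ 0 := pow_ne_zero _ (by norm_num)
    have h2 : ((-1 : ℂ)) ^ (j + 1) * (-1) ^ (j + 1) = 1 := by
      rw [← mul_pow]; norm_num
    rw [show 2 * (j + 1) = 2 * j + 2 by ring]
    field_simp
    linear_combination -h2
  rw [hval] at h
  refine h.congr' ?_
  filter_upwards [self_mem_nhdsWithin] with q hq
  have hl : ((Real.log q : ℝ) : ℂ) ≠ 0 := by
    exact_mod_cast (Real.log_neg hq.1 hq.2).ne
  simp only [eisensteinMod, eisenstein, ← hZ, ← hW, Function.comp]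
  rw [show 2 * (j + 1) - 1 = 2 * j + 1 by omega, show 2 * (j + 1) = 2 * j + 2 by ring]
  set S := ∑' n : ℕ, (∑ d ∈ Nat.divisors (n + 1), (d : ℝ) ^ (2 * j + 1)) * q ^ (n + 1)
  push_cast
  field_simp
  ring

/-- For `k, l ≥ 1`, the ratio `Ẽ_{2k}(q)·Ẽ_{2l}(q) / Ẽ_{2k+2l}(q)`
tends to `1` as `q → 1⁻`. -/
theorem eisensteinMod_mul_asymptotic (k l : ℕ) (hk : 1 ≤ k) (hl : 1 ≤ l) :
    Tendsto (fun q : ℝ => eisensteinMod k q * eisensteinMod l q / eisensteinMod (k + l) q)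
      (𝓝[Set.Ioo (0 : ℝ) 1] 1) (𝓝 1) := by
  have hpi : (2 * (π : ℂ)) ≠ 0 := by
    simp [Real.pi_ne_zero]
  have hne : ((-1 : ℂ)) ^ (k + l) * (2 * (π : ℂ)) ^ (2 * (k + l)) ≠ 0 :=
    mul_ne_zero (pow_ne_zero _ (by norm_num)) (pow_ne_zero _ hpi)
  have h := ((eisensteinMod_tendsto k hk).mul (eisensteinMod_tendsto l hl)).div
    (eisensteinMod_tendsto (k + l) (by omega)) hne
  have hv : ((-1) ^ k * (2 * (π : ℂ)) ^ (2 * k)) * ((-1) ^ l * (2 * (π : ℂ)) ^ (2 * l)) /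
      ((-1) ^ (k + l) * (2 * (π : ℂ)) ^ (2 * (k + l))) = 1 := by
    rw [div_eq_one_iff_eq hne]; ring
  rw [hv] at h
  refine h.congr' ?_
  filter_upwards [self_mem_nhdsWithin] with q hq
  have hl : ((-Real.log q : ℝ) : ℂ) ≠ 0 := by
    have := (Real.log_neg hq.1 hq.2).ne
    exact_mod_cast neg_ne_zero.2 this
  simp only [Pi.div_apply]
  rw [show ((-Real.log q : ℝ) : ℂ) ^ (2 * k) * eisensteinMod k q *
    (((-Real.log q : ℝ) : ℂ) ^ (2 * l) * eisensteinMod l q) =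
    ((-Real.log q : ℝ) : ℂ) ^ (2 * (k + l)) * (eisensteinMod k q * eisensteinMod l q) by ring,
    mul_div_mul_left _ _ (pow_ne_zero _ hl)]
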